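/- The set D, the closure of the image of the multiple-point set of F, is purely (n−1)-dimensional (where this includes the possibility that D is empty). -/

import Mathlib

namespace DPD
section
open Set Filter Topology Metric
open scoped ENNReal NNReal ContDiff

/-- local-to-global for the Hausdorff dimension -/
lemma dimH_le_of_local {X : Type*} [EMetricSpace X] [SecondCountableTopology X] {s : Set X}
    {r : ℝ≥0∞} (h : ∀ x ∈ s, ∃ t ∈ 𝓝 x, dimH (s ∩ t) ≤ r) : dimH s ≤ r := by
  by_contra hlt
  push Not at hlt
  obtain ⟨x, hx, H⟩ := exists_mem_nhdsWithin_lt_dimH_of_lt_dimH hlt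
  obtain ⟨t, ht, htr⟩ := h x hx
  exact absurd (H (s ∩ t) (inter_mem self_mem_nhdsWithin (mem_nhdsWithin_of_mem_nhds ht)))
    (not_lt.2 htr)

lemma finrank_real (N : ℕ) : Module.finrank ℝ (Fin N → ℂ) = 2 * N := by
  rw [finrank_real_of_complex]; simp

lemma dimH_le_two_mul {N : ℕ} (s : Set (Fin N → ℂ)) : dimH s ≤ 2 * (N : ℝ≥0∞) := by
  refine (dimH_mono (subset_univ s)).trans ?_
  rw [Real.dimH_univ_eq_finrank, finrank_real]; simp

/-- analytic maps do not increase Hausdorff dimension. -/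
lemma dimH_image_le_of_analytic {N : ℕ} {F : Type*} [NormedAddCommGroup F] [NormedSpace ℂ F]
    {f : (Fin N → ℂ) → F} {s : Set (Fin N → ℂ)}
    (hf : ∀ x ∈ s, AnalyticAt ℂ f x) : dimH (f '' s) ≤ dimH s := by
  apply dimH_image_le_of_locally_lipschitzOn
  intro x hx
  obtain ⟨K, t, ht, hK⟩ := (hf x hx).hasStrictFDerivAt.exists_lipschitzOnWith
  exact ⟨K, t, mem_nhdsWithin_of_mem_nhds ht, hK⟩

/-- iterated directional derivatives -/
noncomputable def dd {E : Type*} [NormedAddCommGroup E] [NormedSpace ℂ E] (e : E) (g : E → ℂ) :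
    ℕ → E → ℂ
  | 0 => g
  | j + 1 => fun x => fderiv ℂ (dd e g j) x e

variable {E : Type*} [NormedAddCommGroup E] [NormedSpace ℂ E]

lemma dd_analyticAt {e : E} {g : E → ℂ} {y : E} (hg : AnalyticAt ℂ g y) (j : ℕ) :
    AnalyticAt ℂ (dd e g j) y := by
  induction j with
  | zero => exact hg
  | succ j ih =>
    have := ih.fderiv
    exact (ContinuousLinearMap.analyticAt (ContinuousLinearMap.apply ℂ ℂ e) _).comp this

lemma dd_line {e p : E} {g : E → ℂ} {t : ℂ} (hg : AnalyticAt ℂ g (p + t • e)) (j : ℕ) :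
    HasDerivAt (fun t : ℂ => dd e g j (p + t • e)) (dd e g (j + 1) (p + t • e)) t := by
  have h1 := (dd_analyticAt (e := e) hg j).differentiableAt.hasFDerivAt
  have h2 : HasDerivAt (fun t : ℂ => p + t • e) e t := by
    simpa using ((hasDerivAt_id t).smul_const e).const_add p
  exact h1.comp_hasDerivAt t h2

lemma exists_dir {g : E → ℂ} {y : E} (hg : AnalyticAt ℂ g y)
    (hne : ¬ ∀ᶠ x in 𝓝 y, g x = 0) {S : Set E} (hS : Dense S) :
    ∃ e ∈ S, ∃ k, dd e g k y ≠ 0 := by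
  by_contra hcon
  push Not at hcon
  obtain ⟨r, hr, hball⟩ := Metric.eventually_nhds_iff_ball.1 hg.eventually_analyticAt
  have hO : IsOpen {x | x ∈ ball y r ∧ g x ≠ 0} := by
    rw [isOpen_iff_mem_nhds]
    rintro x ⟨hx, hgx⟩
    exact inter_mem (isOpen_ball.mem_nhds hx) ((hball x hx).continuousAt.eventually_ne hgx)
  have hO' : {x | x ∈ ball y r ∧ g x ≠ 0}.Nonempty := by
    by_contra hemp
    apply hne
    filter_upwards [ball_mem_nhds y hr] with x hx
    by_contra hgx
    exact hemp ⟨x, hx, hgx⟩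
  obtain ⟨x, hxO, e, heS, hex⟩ := (((Function.Surjective.denseRange
    (f := fun v => y + v) (fun v => ⟨v - y, by simp⟩)).dense_image (by fun_prop)
    hS).inter_open_nonempty _ hO hO')
  simp only at hex
  subst hex
  set h : ℂ → ℂ := fun t => g (y + t • e) with hh
  set C : Set ℂ := (fun t : ℂ => y + t • e) ⁻¹' ball y r with hC
  have hCconv : Convex ℝ C := by
    intro a ha b hb s t hs ht hst
    have := (convex_ball y r) ha hb hs ht hst
    simp only [hC, mem_preimage]
    convert this using 1
    have : y = s • y + t • y := by rw [← add_smul, hst, one_smul]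
    conv_lhs => rw [this]
    rw [add_smul, smul_add, smul_add, smul_assoc, smul_assoc]
    abel
  have hCo : IsOpen C := isOpen_ball.preimage (by fun_prop)
  have h0C : (0 : ℂ) ∈ C := by simp [hC, hr]
  have h1C : (1 : ℂ) ∈ C := by simpa [hC] using hxO.1
  have hA : AnalyticOnNhd ℂ h C := by
    intro t ht
    exact AnalyticAt.comp (g := g) (f := fun t : ℂ => y + t • e) (hball _ ht) (by fun_prop)
  have hit : ∀ j, ∀ t ∈ C, iteratedDeriv j h t = dd e g j (y + t • e) := by
    intro j
    induction j with
    | zero => intro t _; simp [dd, hh]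
    | succ j ih =>
      intro t ht
      rw [iteratedDeriv_succ]
      have : iteratedDeriv j h =ᶠ[𝓝 t] fun t => dd e g j (y + t • e) := by
        filter_upwards [hCo.mem_nhds ht] with s hs using ih s hs
      rw [this.deriv_eq]
      exact (dd_line (hball _ ht) j).deriv
  have hord : analyticOrderAt h 0 = ⊤ := by
    rw [ENat.eq_top_iff_forall_ge]
    intro m
    rw [natCast_le_analyticOrderAt_iff_iteratedDeriv_eq_zero (hA 0 h0C)]
    intro i _
    rw [hit i 0 h0C]
    simpa using hcon e heS i
  have hev := analyticOrderAt_eq_top.1 hord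
  have := hA.eqOn_zero_of_preconnected_of_eventuallyEq_zero hCconv.isPreconnected h0C hev h1C
  apply hxO.2
  simpa [hh] using this

/-- one-variable Taylor estimate. -/
lemma taylor_est (k : ℕ) : ∀ (h : ℕ → ℂ → ℂ) (c : ℂ) (ε R : ℝ),
    (∀ j < k, ∀ t ∈ ball (0 : ℂ) R, HasDerivAt (h j) (h (j + 1) t) t) →
    (∀ j < k, h j 0 = 0) → (∀ t ∈ ball (0 : ℂ) R, ‖h k t - c‖ ≤ ε) →
    ∀ t ∈ ball (0 : ℂ) R, ‖h 0 t - c * t ^ k / (k.factorial : ℂ)‖ ≤ ε * ‖t‖ ^ k := by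
  induction k with
  | zero => intro h c ε R _ _ h3 t ht; simpa using h3 t ht
  | succ k ih =>
    intro h c ε R h1 h2 h3 t ht
    have hR : 0 < R := pos_of_mem_ball ht
    have IH := ih (fun j => h (j + 1)) c ε R (fun j hj => h1 (j + 1) (by omega))
      (fun j hj => h2 (j + 1) (by omega)) h3
    have hε : 0 ≤ ε := (norm_nonneg _).trans (h3 0 (mem_ball_self hR))
    have hsub : closedBall (0 : ℂ) ‖t‖ ⊆ ball 0 R := by
      apply closedBall_subset_ball; simpa using ht
    have key := (convex_closedBall (0 : ℂ) ‖t‖).norm_image_sub_le_of_norm_hasDerivWithin_le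
      (f := fun s => h 0 s - c * s ^ (k + 1) / ((k + 1).factorial : ℂ))
      (f' := fun s => h 1 s - c * s ^ k / (k.factorial : ℂ)) (C := ε * ‖t‖ ^ k) (x := 0) (y := t)
      (by
        intro s hs
        apply HasDerivAt.hasDerivWithinAt
        have := (h1 0 (by omega) s (hsub hs)).fun_sub
          (((hasDerivAt_pow (k + 1) s).const_mul c).div_const ((k + 1).factorial : ℂ))
        refine this.congr_deriv ?_
        rw [Nat.factorial_succ]
        have : (k.factorial : ℂ) ≠ 0 := by exact_mod_cast k.factorial_ne_zero
        have : (k + 1 : ℂ) ≠ 0 := by exact_mod_cast k.succ_ne_zero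
        push_cast
        field_simp)
      (by
        intro s hs
        refine (IH s (hsub hs)).trans ?_
        gcongr
        simpa using hs)
      (by simp) (by simp)
    simp only [h2 0 (by omega)] at key
    simpa [pow_succ, mul_assoc] using key

lemma exists_proj {N : ℕ} {e : Fin (N + 1) → ℂ} (he : e ≠ 0) :
    ∃ ρ : (Fin (N + 1) → ℂ) →L[ℂ] (Fin N → ℂ), ∀ v, ρ v = 0 → ∃ t : ℂ, v = t • e := by
  have h1 : Module.finrank ℂ ((Fin (N + 1) → ℂ) ⧸ (ℂ ∙ e)) = Module.finrank ℂ (Fin N → ℂ) := by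
    have := Submodule.finrank_quotient_add_finrank (ℂ ∙ e)
    rw [finrank_span_singleton he] at this
    simp at this ⊢
    omega
  let L := LinearEquiv.ofFinrankEq _ _ h1
  refine ⟨LinearMap.toContinuousLinearMap (L.toLinearMap ∘ₗ (ℂ ∙ e).mkQ), ?_⟩
  intro v hv
  have : L ((ℂ ∙ e).mkQ v) = 0 := hv
  rw [LinearEquiv.map_eq_zero_iff, Submodule.mkQ_apply, Submodule.Quotient.mk_eq_zero,
    Submodule.mem_span_singleton] at this
  obtain ⟨t, ht⟩ := this
  exact ⟨t, ht.symm⟩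

/-- Chart for a smooth hypersurface. -/
lemma chart {N : ℕ} {φ : (Fin (N + 1) → ℂ) → ℂ} {y e : Fin (N + 1) → ℂ}
    (hφ : AnalyticAt ℂ φ y) (h0 : φ y = 0) (he : fderiv ℂ φ y e ≠ 0) :
    ∃ (ρ : (Fin (N + 1) → ℂ) →L[ℂ] (Fin N → ℂ)) (σ : (Fin N → ℂ) → (Fin (N + 1) → ℂ)),
      (∀ v, ρ v = 0 → ∃ t : ℂ, v = t • e) ∧ AnalyticAt ℂ σ (ρ y) ∧ σ (ρ y) = y ∧
      (∀ᶠ τ in 𝓝 (ρ y), φ (σ τ) = 0 ∧ ρ (σ τ) = τ) ∧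
      (∀ᶠ x in 𝓝 y, φ x = 0 → σ (ρ x) = x) := by
  have he0 : e ≠ 0 := by rintro rfl; simp at he
  obtain ⟨ρ, hρ⟩ := exists_proj he0
  set Φ : (Fin (N + 1) → ℂ) → ℂ × (Fin N → ℂ) := fun x => (φ x, ρ x) with hΦ
  have hΦa : AnalyticAt ℂ Φ y := hφ.prod (ρ.analyticAt y)
  have hd : HasFDerivAt Φ ((fderiv ℂ φ y).prod ρ) y :=
    hφ.differentiableAt.hasFDerivAt.prodMk ρ.hasFDerivAt
  have hker : LinearMap.ker (((fderiv ℂ φ y).prod ρ :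
      (Fin (N + 1) → ℂ) →L[ℂ] ℂ × (Fin N → ℂ)) : (Fin (N + 1) → ℂ) →ₗ[ℂ] ℂ × (Fin N → ℂ)) = ⊥ := by
    rw [LinearMap.ker_eq_bot']
    intro v hv
    have hv' : fderiv ℂ φ y v = 0 ∧ ρ v = 0 := by simpa [Prod.ext_iff] using hv
    obtain ⟨t, rfl⟩ := hρ v hv'.2
    have := hv'.1
    rw [map_smul, smul_eq_mul, mul_eq_zero] at this
    rw [this.resolve_right he, zero_smul]
  let A : (Fin (N + 1) → ℂ) ≃L[ℂ] ℂ × (Fin N → ℂ) :=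
    (LinearEquiv.ofInjectiveOfFinrankEq _ (LinearMap.ker_eq_bot.1 hker)
      (by simp [add_comm])).toContinuousLinearEquiv
  have hA : HasFDerivAt Φ (A : (Fin (N + 1) → ℂ) →L[ℂ] ℂ × (Fin N → ℂ)) y := by
    convert hd using 1
    exact ContinuousLinearMap.ext fun v => rfl
  have hC : ContDiffAt ℂ ω Φ y := hΦa.contDiffAt
  have hs := hC.hasStrictFDerivAt' hA (by simp)
  have hinv := hC.to_localInverse hA (by simp)
  have hinva : AnalyticAt ℂ (hC.localInverse hA (by simp)) (Φ y) := hinv.analyticAt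
  have hΦy : Φ y = (0, ρ y) := by simp [hΦ, h0]
  refine ⟨ρ, fun τ => hC.localInverse hA (by simp) (0, τ), hρ, ?_, ?_, ?_, ?_⟩
  · rw [hΦy] at hinva
    exact hinva.fun_comp (by fun_prop)
  · have := hC.localInverse_apply_image hA (by simp)
    rwa [hΦy] at this
  · have := hs.eventually_right_inverse
    rw [hΦy] at this
    have hcont : Tendsto (fun τ : Fin N → ℂ => ((0 : ℂ), τ)) (𝓝 (ρ y)) (𝓝 (0, ρ y)) :=
      Continuous.tendsto (by fun_prop) _
    filter_upwards [hcont.eventually this] with τ hτ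
    have h' : Φ (hC.localInverse hA (by simp) (0, τ)) = (0, τ) := hτ
    simp only [hΦ, Prod.mk.injEq] at h'
    exact h'
  · filter_upwards [hs.eventually_left_inverse] with x hx h0x
    have h' : hC.localInverse hA (by simp) (Φ x) = x := hx
    simpa only [hΦ, h0x] using h'

end
end DPD

namespace DPD
section
open Set Filter Topology Metric
open scoped ENNReal NNReal ContDiff

lemma exists_order {E : Type*} [NormedAddCommGroup E] [NormedSpace ℂ E] {e y : E} {g : E → ℂ}
    (h0 : g y = 0) (h : ∃ k, dd e g k y ≠ 0) :
    ∃ k, (∀ j ≤ k, dd e g j y = 0) ∧ dd e g (k + 1) y ≠ 0 := by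
  classical
  have hs := Nat.find_spec h
  have hm : ∀ j < Nat.find h, dd e g j y = 0 := fun j hj => by simpa using Nat.find_min h hj
  rcases hk : Nat.find h with _ | k
  · rw [hk] at hs; exact absurd h0 hs
  · rw [hk] at hs hm
    exact ⟨k, fun j hj => hm j (by omega), hs⟩

/-- The zero set of a nonzero analytic function has complex codimension at least one. -/
lemma dimH_zero {N : ℕ} {J : (Fin (N + 1) → ℂ) → ℂ} {O : Set (Fin (N + 1) → ℂ)}
    (hJ : ∀ x ∈ O, AnalyticAt ℂ J x) (hne : ∀ x ∈ O, ¬ ∀ᶠ z in 𝓝 x, J z = 0) :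
    dimH {x ∈ O | J x = 0} ≤ 2 * (N : ℝ≥0∞) := by
  let d : ℕ → (Fin (N + 1) → ℂ) := TopologicalSpace.denseSeq _
  let S : ℕ × ℕ → Set (Fin (N + 1) → ℂ) :=
    fun m => {x ∈ O | dd (d m.1) J m.2 x = 0 ∧ dd (d m.1) J (m.2 + 1) x ≠ 0}
  have hsub : {x ∈ O | J x = 0} ⊆ ⋃ m, S m := by
    rintro x ⟨hx, hx0⟩
    obtain ⟨e, ⟨m, rfl⟩, hk⟩ := exists_dir (hJ x hx) (hne x hx)
      (TopologicalSpace.denseRange_denseSeq (Fin (N + 1) → ℂ))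
    obtain ⟨k, h1, h2⟩ := exists_order hx0 hk
    exact mem_iUnion.2 ⟨(m, k), hx, h1 k le_rfl, h2⟩
  refine (dimH_mono hsub).trans ?_
  rw [dimH_iUnion]
  refine iSup_le fun m => dimH_le_of_local ?_
  rintro x ⟨hx, h1, h2⟩
  obtain ⟨ρ, σ, -, hσ, -, -, hN⟩ := chart (dd_analyticAt (hJ x hx) m.2) h1 h2
  have hc := (ρ.continuous.tendsto x).eventually hσ.eventually_analyticAt
  refine ⟨_, hN.and hc, ?_⟩
  calc _ ≤ dimH (σ '' {τ | AnalyticAt ℂ σ τ}) := by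
        apply dimH_mono
        rintro z ⟨hz, hz1, hz2⟩
        exact ⟨ρ z, hz2, hz1 hz.2.1⟩
    _ ≤ _ := (dimH_image_le_of_analytic (fun x hx => hx)).trans (dimH_le_two_mul _)

/-- A set separating an open convex set has real codimension at most one. -/
lemma dimH_frontier {E : Type*} [NormedAddCommGroup E] [NormedSpace ℝ E] [FiniteDimensional ℝ E]
    {K Ω : Set E} (hΩ : IsOpen Ω) (hc : Convex ℝ Ω) {p q : E} (hp : p ∈ Ω) (hq : q ∈ Ω)
    (hpK : K ∈ 𝓝 p) (hqK : Kᶜ ∈ 𝓝 q) :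
    (Module.finrank ℝ E : ℝ≥0∞) ≤ dimH (frontier K ∩ Ω) + 1 := by
  set v := q - p with hv
  have hv0 : v ≠ 0 := by
    intro h
    have : q = p := sub_eq_zero.1 h
    subst this
    exact (mem_of_mem_nhds hqK) (mem_of_mem_nhds hpK)
  have : IsClosed ((ℝ ∙ v : Submodule ℝ E) : Set E) := Submodule.closed_of_finiteDimensional _
  let Q := E ⧸ (ℝ ∙ v)
  let π : E →L[ℝ] Q := (ℝ ∙ v).mkQL
  have h1 : K ∩ Ω ∈ 𝓝 p := inter_mem hpK (hΩ.mem_nhds hp)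
  have h2 : (fun x => x + v) ⁻¹' (Kᶜ ∩ Ω) ∈ 𝓝 p := by
    apply (Continuous.tendsto (by fun_prop : Continuous fun x : E => x + v) p)
    have : p + v = q := by simp [hv]
    rw [this]
    exact inter_mem hqK (hΩ.mem_nhds hq)
  have hopen : IsOpenMap π := (ℝ ∙ v).isOpenMap_mkQ
  have h3 : π '' (K ∩ Ω ∩ (fun x => x + v) ⁻¹' (Kᶜ ∩ Ω)) ∈ 𝓝 (π p) :=
    hopen.image_mem_nhds (inter_mem h1 h2)
  have hsub : π '' (K ∩ Ω ∩ (fun x => x + v) ⁻¹' (Kᶜ ∩ Ω)) ⊆ π '' (frontier K ∩ Ω) := by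
    rintro _ ⟨x, ⟨⟨hxK, hxΩ⟩, hyK, hyΩ⟩, rfl⟩
    have hseg : IsPreconnected (segment ℝ x (x + v)) := (convex_segment _ _).isPreconnected
    have hne : (segment ℝ x (x + v) ∩ frontier K).Nonempty := by
      by_contra hcon
      rw [not_nonempty_iff_eq_empty] at hcon
      have := hseg (interior K) (closure K)ᶜ isOpen_interior isClosed_closure.isOpen_compl
        (by
          intro z hz
          by_contra hz'
          simp only [mem_union, not_or, mem_compl_iff, not_not] at hz'
          have : z ∈ segment ℝ x (x + v) ∩ frontier K := ⟨hz, hz'.2, hz'.1⟩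
          rw [hcon] at this; exact this)
        ⟨x, left_mem_segment _ _ _, by
          by_contra hx
          have : x ∈ segment ℝ x (x + v) ∩ frontier K :=
            ⟨left_mem_segment _ _ _, subset_closure hxK, hx⟩
          rw [hcon] at this; exact this⟩
        ⟨x + v, right_mem_segment _ _ _, by
          intro hx
          have : x + v ∈ segment ℝ x (x + v) ∩ frontier K :=
            ⟨right_mem_segment _ _ _, hx, fun h => hyK (interior_subset h)⟩
          rw [hcon] at this; exact this⟩
      obtain ⟨z, _, hz1, hz2⟩ := this
      exact hz2 (subset_closure (interior_subset hz1))
    obtain ⟨z, hz, hzf⟩ := hne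
    refine ⟨z, ⟨hzf, hc.segment_subset hxΩ hyΩ hz⟩, ?_⟩
    rw [segment_eq_image'] at hz
    obtain ⟨θ, _, rfl⟩ := hz
    have : π v = 0 := by
      change (ℝ ∙ v).mkQ v = 0
      simp [Submodule.mem_span_singleton_self]
    simp [this]
  have h4 : dimH (π '' (K ∩ Ω ∩ (fun x => x + v) ⁻¹' (Kᶜ ∩ Ω))) = Module.finrank ℝ Q :=
    Real.dimH_of_mem_nhds h3
  have h5 : Module.finrank ℝ Q + 1 = Module.finrank ℝ E := by
    have := Submodule.finrank_quotient_add_finrank (ℝ ∙ v)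
    rwa [finrank_span_singleton hv0] at this
  rw [← h5]
  push_cast
  gcongr
  rw [← h4]
  exact (dimH_mono hsub).trans (π.lipschitz.dimH_image_le _)

noncomputable def jac {N : ℕ} (f : (Fin N → ℂ) → (Fin N → ℂ)) (x : Fin N → ℂ) : ℂ :=
  LinearMap.det (fderiv ℂ f x : (Fin N → ℂ) →ₗ[ℂ] (Fin N → ℂ))

lemma jac_analytic {N : ℕ} {f : (Fin N → ℂ) → (Fin N → ℂ)} {x : Fin N → ℂ}
    (hf : AnalyticAt ℂ f x) : AnalyticAt ℂ (jac f) x := by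
  have : jac f = fun x => ∑ s : Equiv.Perm (Fin N), (Equiv.Perm.sign s : ℂ) *
      ∏ i, fderiv ℂ f x (Pi.single i 1) (s i) := by
    ext z
    rw [jac, ← LinearMap.det_toMatrix', Matrix.det_apply']
    simp [LinearMap.toMatrix'_apply]
  rw [this]
  refine Finset.analyticAt_fun_sum _ fun s _ => analyticAt_const.mul ?_
  refine Finset.analyticAt_fun_prod _ fun i _ => ?_
  exact (((ContinuousLinearMap.proj (s i)).comp
    (ContinuousLinearMap.apply ℂ (Fin N → ℂ) (Pi.single i (1 : ℂ)))).analyticAt _).comp hf.fderiv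

lemma image_mem_of_jac {N : ℕ} {f : (Fin N → ℂ) → (Fin N → ℂ)} {x : Fin N → ℂ}
    (hf : AnalyticAt ℂ f x) (hj : jac f x ≠ 0) {O : Set (Fin N → ℂ)} (hO : O ∈ 𝓝 x) :
    f '' O ∈ 𝓝 (f x) := by
  rw [← hf.hasStrictFDerivAt.map_nhds_eq_of_surj]
  · exact image_mem_map hO
  · have := LinearMap.equivOfDetNeZero (fderiv ℂ f x : (Fin N → ℂ) →ₗ[ℂ] (Fin N → ℂ)) hj
    rw [LinearMap.range_eq_top]
    exact (LinearMap.equivOfDetNeZero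
      (fderiv ℂ f x : (Fin N → ℂ) →ₗ[ℂ] (Fin N → ℂ)) hj).surjective

lemma omt0 {N : ℕ} {f : (Fin (N+1) → ℂ) → (Fin (N+1) → ℂ)} {a : Fin (N+1) → ℂ} {r δ : ℝ}
    (hr : 0 < r) (hf : ∀ x ∈ closedBall a r, AnalyticAt ℂ f x) (hj : jac f a ≠ 0)
    (hδ : ∀ x ∈ sphere a r, δ ≤ ‖f x - f a‖) : ball (f a) δ ⊆ f '' closedBall a r := by
  intro q hq
  by_contra hqK
  have hK : IsCompact (f '' closedBall a r) := (isCompact_closedBall a r).image_of_continuousOn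
    fun x hx => (hf x hx).continuousAt.continuousWithinAt
  have hδ0 : 0 < δ := pos_of_mem_ball hq
  have key := dimH_frontier (E := Fin (N+1) → ℂ) (K := f '' closedBall a r) isOpen_ball
    (convex_ball (f a) δ) (mem_ball_self hδ0) hq
    (image_mem_of_jac (hf a (mem_closedBall_self hr.le)) hj (closedBall_mem_nhds a hr))
    (hK.isClosed.isOpen_compl.mem_nhds hqK)
  have hb : ∀ x ∈ ball a r, AnalyticAt ℂ f x := fun x hx => hf x (ball_subset_closedBall hx)
  have hJ : AnalyticOnNhd ℂ (jac f) (ball a r) := fun x hx => jac_analytic (hb x hx)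
  have hsub : frontier (f '' closedBall a r) ∩ ball (f a) δ ⊆ f '' {x ∈ ball a r | jac f x = 0} := by
    rintro z ⟨hz, hzb⟩
    obtain ⟨x, hx, rfl⟩ : z ∈ f '' closedBall a r := hK.isClosed.closure_eq ▸ hz.1
    have hxb : x ∈ ball a r := by
      rw [← sphere_union_ball] at hx
      refine hx.resolve_left fun hs => ?_
      have := hδ x hs
      rw [mem_ball, dist_eq_norm] at hzb
      linarith
    refine ⟨x, ⟨hxb, ?_⟩, rfl⟩
    by_contra hjx
    apply hz.2
    rw [mem_interior_iff_mem_nhds]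
    exact mem_of_superset (image_mem_of_jac (hb x hxb) hjx (isOpen_ball.mem_nhds hxb))
      (image_mono ball_subset_closedBall)
  have hd : dimH (frontier (f '' closedBall a r) ∩ ball (f a) δ) ≤ 2 * (N : ℝ≥0∞) := by
    refine (dimH_mono hsub).trans ((dimH_image_le_of_analytic fun x hx => hb x hx.1).trans ?_)
    refine dimH_zero hJ ?_
    intro x hx hev
    exact hj (hJ.eqOn_zero_of_preconnected_of_eventuallyEq_zero
      (convex_ball a r).isPreconnected hx hev (mem_ball_self hr))
  rw [finrank_real] at key
  have : ((2 * (N + 1) : ℕ) : ℝ≥0∞) ≤ ((2 * N + 1 : ℕ) : ℝ≥0∞) := by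
    refine key.trans ?_
    push_cast
    gcongr
  have := (Nat.cast_le (α := ℝ≥0∞)).1 this
  omega

/-- Open mapping theorem at isolated points of fibres. -/
lemma omt {N : ℕ} {f : (Fin N → ℂ) → (Fin N → ℂ)} {a : Fin N → ℂ}
    (hf : AnalyticAt ℂ f a) (hiso : ∀ᶠ x in 𝓝 a, f x = f a → x = a) {O : Set (Fin N → ℂ)}
    (hO : O ∈ 𝓝 a) : f '' O ∈ 𝓝 (f a) := by
  rcases N with _ | N
  · have : f '' O = univ := by
      rw [eq_univ_iff_forall]; intro x
      exact ⟨a, mem_of_mem_nhds hO, Subsingleton.elim _ _⟩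
    rw [this]; exact univ_mem
  obtain ⟨r, hr, hball⟩ := Metric.nhds_basis_closedBall.mem_iff.1
    (inter_mem hO (inter_mem hf.eventually_analyticAt hiso))
  have hfa : ∀ x ∈ closedBall a r, AnalyticAt ℂ f x := fun x hx => (hball hx).2.1
  have hfc : ContinuousOn f (closedBall a r) :=
    fun x hx => (hfa x hx).continuousAt.continuousWithinAt
  have hne : (sphere a r).Nonempty := NormedSpace.sphere_nonempty.2 hr.le
  obtain ⟨x0, hx0, hmin⟩ := (isCompact_sphere a r).exists_isMinOn hne
    (f := fun x => ‖f x - f a‖)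
    ((hfc.mono sphere_subset_closedBall).sub continuousOn_const).norm
  set δ := ‖f x0 - f a‖ with hδdef
  have hδ : 0 < δ := by
    rw [hδdef, norm_pos_iff, sub_ne_zero]
    intro h
    have := (hball (sphere_subset_closedBall hx0)).2.2 h
    rw [this] at hx0
    simp at hx0
    exact hr.ne hx0
  have hK : IsClosed (f '' closedBall a r) :=
    ((isCompact_closedBall a r).image_of_continuousOn hfc).isClosed
  refine mem_of_superset (ball_mem_nhds (f a) (half_pos hδ)) ?_
  refine Subset.trans ?_ (image_mono fun x hx => (hball hx).1 : f '' closedBall a r ⊆ _)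
  intro c hc
  rw [← hK.closure_eq, Metric.mem_closure_iff]
  intro η hη
  -- choose a small perturbation
  have hfin := Module.End.finite_hasEigenvalue
    (-(fderiv ℂ f a : (Fin (N+1) → ℂ) →ₗ[ℂ] (Fin (N+1) → ℂ)))
  have e1 : ∀ᶠ ε : ℂ in 𝓝[≠] 0, ¬ Module.End.HasEigenvalue
      (-(fderiv ℂ f a : (Fin (N+1) → ℂ) →ₗ[ℂ] (Fin (N+1) → ℂ))) ε := by
    have hcl := (hfin.subset (sdiff_subset (t := {(0 : ℂ)}))).isClosed
    have : ∀ᶠ ε : ℂ in 𝓝 0, ε ∉ {μ | Module.End.HasEigenvalue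
      (-(fderiv ℂ f a : (Fin (N+1) → ℂ) →ₗ[ℂ] (Fin (N+1) → ℂ))) μ} \ {0} :=
      hcl.isOpen_compl.mem_nhds (by simp)
    filter_upwards [mem_nhdsWithin_of_mem_nhds this, self_mem_nhdsWithin] with ε h1 h2 h3
    exact h1 ⟨h3, h2⟩
  have e2 : ∀ᶠ ε : ℂ in 𝓝[≠] 0, ‖ε‖ * r < min η (δ / 2) := by
    apply eventually_nhdsWithin_of_eventually_nhds
    have : Tendsto (fun ε : ℂ => ‖ε‖ * r) (𝓝 0) (𝓝 (‖(0 : ℂ)‖ * r)) :=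
      Continuous.tendsto (by fun_prop) _
    rw [norm_zero, zero_mul] at this
    exact this.eventually_lt_const (lt_min hη (half_pos hδ))
  obtain ⟨ε, hε1, hε2⟩ := (e1.and e2).exists
  set F : (Fin (N+1) → ℂ) → (Fin (N+1) → ℂ) := fun x => f x + ε • (x - a) with hF
  have hFa : F a = f a := by simp [hF]
  have hsmall : ∀ x ∈ closedBall a r, ‖ε • (x - a)‖ < min η (δ / 2) := by
    intro x hx
    rw [norm_smul]
    refine lt_of_le_of_lt ?_ hε2
    rw [mem_closedBall, dist_eq_norm] at hx
    gcongr
  have hc' : c ∈ F '' closedBall a r := by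
    refine omt0 (δ := δ / 2) hr ?_ ?_ ?_ ?_
    · intro x hx
      exact (hfa x hx).add (by fun_prop)
    · intro hj
      have hd : HasFDerivAt F (fderiv ℂ f a + ε • ContinuousLinearMap.id ℂ _) a :=
        (hfa a (mem_closedBall_self hr.le)).differentiableAt.hasFDerivAt.add
          (((hasFDerivAt_id a).sub_const a).const_smul ε)
      rw [jac, hd.fderiv] at hj
      have := LinearMap.bot_lt_ker_of_det_eq_zero hj
      obtain ⟨v, hv, hv0⟩ := (Submodule.ne_bot_iff _).1 this.ne'
      apply hε1
      refine Module.End.hasEigenvalue_of_hasEigenvector (x := v) ?_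
      rw [Module.End.hasEigenvector_iff, Module.End.mem_eigenspace_iff]
      refine ⟨?_, hv0⟩
      have hv' : fderiv ℂ f a v + ε • v = 0 := by simpa using hv
      simp only [LinearMap.neg_apply]
      exact neg_eq_of_add_eq_zero_right hv'
    · intro x hx
      rw [hFa]
      have h1 : δ ≤ ‖f x - f a‖ := hmin hx
      have h2 := (hsmall x (sphere_subset_closedBall hx)).trans_le (min_le_right _ _)
      have h3 : F x - f a = (f x - f a) + ε • (x - a) := by simp only [hF]; abel
      rw [h3]
      have := norm_sub_le_norm_add (f x - f a) (ε • (x - a))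
      linarith
    · rwa [hFa]
  obtain ⟨x, hx, rfl⟩ := hc'
  refine ⟨f x, mem_image_of_mem f hx, ?_⟩
  rw [dist_eq_norm]
  have h3 : F x - f x = ε • (x - a) := by simp only [hF]; abel
  rw [h3]
  exact (hsmall x hx).trans_le (min_le_left _ _)

end
end DPD

namespace DPD
section
open Set Filter Topology Metric
open scoped ENNReal NNReal ContDiff

lemma rank_lemma (m : ℕ) : ∀ (N : ℕ) (q : (Fin N → ℂ) → (Fin m → ℂ)) (c : Fin N → ℂ),
    ∀ O ∈ 𝓝 c, AnalyticAt ℂ q c →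
    (∀ᶠ x in 𝓝 c, ∀ᶠ z in 𝓝 x, q z = q x → z = x) →
    ∃ x ∈ O, ∃ ℓ : (Fin m → ℂ) →L[ℂ] (Fin N → ℂ), ∀ᶠ z in 𝓝 x, ℓ (q z) = ℓ (q x) → z = x := by
  intro N
  induction N with
  | zero =>
    intro q c O hO _ _
    exact ⟨c, mem_of_mem_nhds hO, 0, Eventually.of_forall fun z _ => Subsingleton.elim _ _⟩
  | succ N ih =>
    intro q c O hO hq hdisc
    obtain ⟨r, hr, hball⟩ := Metric.nhds_basis_ball.mem_iff.1
      (inter_mem hO (inter_mem hq.eventually_analyticAt hdisc))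
    have hx : ∃ x ∈ ball c r, fderiv ℂ q x ≠ 0 := by
      by_contra hcon
      push Not at hcon
      have hconst : ∀ z ∈ ball c r, q z = q c := fun z hz =>
        (convex_ball c r).is_const_of_fderivWithin_eq_zero (𝕜 := ℂ)
          (fun x hx => (hball hx).2.1.differentiableAt.differentiableWithinAt)
          (fun x hx => by
            rw [fderivWithin_of_isOpen isOpen_ball hx]; exact hcon x hx) hz (mem_ball_self hr)
      have h1 : ∀ᶠ z in 𝓝 c, z = c := by
        filter_upwards [(hball (mem_ball_self hr)).2.2, ball_mem_nhds c hr] with z hz hzb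
        exact hz (hconst z hzb)
      have h2 : ∀ᶠ z in 𝓝[≠] c, False := by
        filter_upwards [mem_nhdsWithin_of_mem_nhds h1, self_mem_nhdsWithin] with z hz hz'
        exact hz' hz
      exact h2.exists.elim fun _ h => h
    obtain ⟨x, hxb, hx0⟩ := hx
    obtain ⟨v, hv⟩ : ∃ v, fderiv ℂ q x v ≠ 0 := by
      by_contra hcon
      push Not at hcon
      exact hx0 (ContinuousLinearMap.ext hcon)
    obtain ⟨i, hi⟩ : ∃ i, fderiv ℂ q x v i ≠ 0 := by
      by_contra hcon
      push Not at hcon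
      exact hv (funext hcon)
    have hqx : AnalyticAt ℂ q x := (hball hxb).2.1
    let pr : (Fin m → ℂ) →L[ℂ] ℂ := ContinuousLinearMap.proj i
    set φ : (Fin (N + 1) → ℂ) → ℂ := fun z => pr (q z) - pr (q x) with hφ
    have hφa : AnalyticAt ℂ φ x := ((pr.analyticAt _).comp hqx).sub analyticAt_const
    have hφd : fderiv ℂ φ x v ≠ 0 := by
      have : HasFDerivAt φ (pr.comp (fderiv ℂ q x)) x :=
        (pr.hasFDerivAt.comp x hqx.differentiableAt.hasFDerivAt).sub_const _
      rw [this.fderiv]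
      exact hi
    obtain ⟨ρ, σ, -, hσ, hσx, hM, hN⟩ := chart hφa (by simp [hφ]) hφd
    have hσt : Tendsto σ (𝓝 (ρ x)) (𝓝 x) := by
      have := hσ.continuousAt.tendsto
      rwa [hσx] at this
    have hT : ∀ᶠ τ in 𝓝 (ρ x), AnalyticAt ℂ σ τ ∧ (φ (σ τ) = 0 ∧ ρ (σ τ) = τ) ∧
        (∀ᶠ τ' in 𝓝 τ, φ (σ τ') = 0 ∧ ρ (σ τ') = τ') ∧
        (∀ᶠ z in 𝓝 (σ τ), φ z = 0 → σ (ρ z) = z) ∧ σ τ ∈ ball c r := by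
      filter_upwards [hσ.eventually_analyticAt, hM, hM.eventually_nhds,
        hσt.eventually hN.eventually_nhds, hσt.eventually (isOpen_ball.mem_nhds hxb)]
        with τ h1 h2 h3 h4 h5 using ⟨h1, h2, h3, h4, h5⟩
    obtain ⟨τ, hτ, ℓ', hℓ'⟩ := ih (q ∘ σ) (ρ x) _ hT
      (by
        refine AnalyticAt.comp ?_ hσ
        rw [hσx]; exact hqx)
      (by
        filter_upwards [hT] with τ hτ
        have h1 := hτ.1.continuousAt.tendsto.eventually (hball hτ.2.2.2.2).2.2
        filter_upwards [h1, hτ.2.2.1] with τ' h1 h2 h3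
        have := h1 h3
        rw [← h2.2, this, hτ.2.1.2])
    obtain ⟨hτ1, hτ2, hτ3, hτ4, hτ5⟩ := hτ
    refine ⟨σ τ, (hball hτ5).1,
      ContinuousLinearMap.pi (Fin.cons pr (fun j => (ContinuousLinearMap.proj j).comp ℓ')), ?_⟩
    have hρt : Tendsto ρ (𝓝 (σ τ)) (𝓝 τ) := by
      have := ρ.continuous.tendsto (σ τ)
      rwa [hτ2.2] at this
    filter_upwards [hτ4, hρt.eventually hℓ'] with z h1 h2 h3
    have h30 : pr (q z) = pr (q (σ τ)) := by simpa using congrFun h3 0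
    have h31 : ℓ' (q z) = ℓ' (q (σ τ)) := by
      ext j
      simpa using congrFun h3 j.succ
    have hz0 : φ z = 0 := by
      have := hτ2.1
      simp only [hφ] at this ⊢
      rw [h30]; exact this
    have hz1 := h1 hz0
    have := h2 (by simp only [Function.comp_apply]; rw [hz1]; exact h31)
    rw [← hz1, this]

lemma smooth_lemma (k m : ℕ) : ∀ (N : ℕ) (Φ : (Fin N → ℂ) → (Fin k → ℂ))
    (P : (Fin N → ℂ) → (Fin m → ℂ)) (z0 : Fin N → ℂ),
    ∀ O ∈ 𝓝 z0, AnalyticAt ℂ Φ z0 → AnalyticAt ℂ P z0 → Φ z0 = 0 →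
    (∀ᶠ x in 𝓝 z0, Φ x = 0 → ∀ᶠ z in 𝓝 x, Φ z = 0 → P z = P x → z = x) →
    ∃ z ∈ O, Φ z = 0 ∧ ∃ (e : ℕ) (ℓ : (Fin m → ℂ) →L[ℂ] (Fin e → ℂ)),
      (∀ᶠ x in 𝓝 z, Φ x = 0 → ℓ (P x) = ℓ (P z) → x = z) ∧
      ∀ O' ∈ 𝓝 z, (fun x => ℓ (P x)) '' (O' ∩ {x | Φ x = 0}) ∈ 𝓝 (ℓ (P z)) := by
  intro N
  induction N with
  | zero =>
    intro Φ P z0 O hO hΦ hP h0 _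
    refine ⟨z0, mem_of_mem_nhds hO, h0, 0, 0,
      Eventually.of_forall fun z _ _ => Subsingleton.elim _ _, ?_⟩
    intro O' hO'
    refine mem_of_superset univ_mem ?_
    intro w _
    exact ⟨z0, ⟨mem_of_mem_nhds hO', h0⟩, Subsingleton.elim _ _⟩
  | succ N ih =>
    intro Φ P z0 O hO hΦ hP h0 hdisc
    by_cases hz : ∀ᶠ x in 𝓝 z0, Φ x = 0
    · have hT : ∀ᶠ x in 𝓝 z0, x ∈ O ∧ AnalyticAt ℂ P x ∧ (∀ᶠ z in 𝓝 x, Φ z = 0) := by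
        filter_upwards [hO, hP.eventually_analyticAt, hz.eventually_nhds] with x h1 h2 h3
          using ⟨h1, h2, h3⟩
      obtain ⟨x, hx, ℓ, hℓ⟩ := rank_lemma m (N + 1) P z0 _ hT hP (by
        filter_upwards [hdisc, hz.eventually_nhds] with x h1 h2
        filter_upwards [h1 h2.self_of_nhds, h2] with z h3 h4 h5 using h3 h4 h5)
      refine ⟨x, hx.1, hx.2.2.self_of_nhds, N + 1, ℓ, hℓ.mono fun z hz _ => hz, ?_⟩
      intro O' hO'
      exact omt (f := fun x => ℓ (P x)) ((ℓ.analyticAt _).comp hx.2.1) hℓ (inter_mem hO' hx.2.2)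
    · obtain ⟨i, hi⟩ : ∃ i, ¬ ∀ᶠ x in 𝓝 z0, Φ x i = 0 := by
        by_contra hcon
        push Not at hcon
        apply hz
        filter_upwards [eventually_all.2 hcon] with x hx using funext hx
      set φ : (Fin (N + 1) → ℂ) → ℂ := fun x => Φ x i with hφ
      have hφa : ∀ x, AnalyticAt ℂ Φ x → AnalyticAt ℂ φ x := fun x hx =>
        ((ContinuousLinearMap.proj (R := ℂ) (φ := fun _ : Fin k => ℂ) i).analyticAt _).comp hx
      obtain ⟨r, hr, hball⟩ := Metric.nhds_basis_ball.mem_iff.1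
        (inter_mem hO (inter_mem hΦ.eventually_analyticAt
          (inter_mem hP.eventually_analyticAt hdisc)))
      have hex : ∃ d, ∃ z ∈ ball z0 r, Φ z = 0 ∧ ∃ u, dd u φ d z ≠ 0 := by
        obtain ⟨u, -, d, hd⟩ := exists_dir (hφa z0 hΦ) hi dense_univ
        exact ⟨d, z0, mem_ball_self hr, h0, u, hd⟩
      classical
      obtain ⟨z, hzb, hzΦ, u, hu⟩ := Nat.find_spec hex
      have hmin : ∀ d < Nat.find hex, ∀ z ∈ ball z0 r, Φ z = 0 → ∀ u, dd u φ d z = 0 := by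
        intro d hd z hz hz' u
        by_contra hcon
        exact Nat.find_min hex hd ⟨z, hz, hz', u, hcon⟩
      generalize Nat.find hex = d at hu hmin
      rcases d with _ | d
      · exact absurd (by simp [dd, hφ, hzΦ]) hu
      have hmin' := hmin d (by omega)
      have hψa : AnalyticAt ℂ (dd u φ d) z := dd_analyticAt (hφa z (hball hzb).2.1) d
      obtain ⟨ρ, σ, -, hσ, hσx, hM, hN⟩ := chart hψa (hmin' z hzb hzΦ u) hu
      have hσt : Tendsto σ (𝓝 (ρ z)) (𝓝 z) := by
        have := hσ.continuousAt.tendsto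
        rwa [hσx] at this
      have hT : ∀ᶠ τ in 𝓝 (ρ z), AnalyticAt ℂ σ τ ∧ ρ (σ τ) = τ ∧
          (∀ᶠ τ' in 𝓝 τ, ρ (σ τ') = τ') ∧
          (∀ᶠ x in 𝓝 (σ τ), dd u φ d x = 0 → σ (ρ x) = x) ∧ σ τ ∈ ball z0 r := by
        filter_upwards [hσ.eventually_analyticAt, hM, hM.eventually_nhds,
          hσt.eventually hN.eventually_nhds, hσt.eventually (isOpen_ball.mem_nhds hzb)]
          with τ h1 h2 h3 h4 h5 using ⟨h1, h2.2, h3.mono fun _ h => h.2, h4, h5⟩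
      obtain ⟨τ, hτ, hτΦ, e, ℓ, hiso, him⟩ := ih (Φ ∘ σ) (P ∘ σ) (ρ z) _ hT
        (AnalyticAt.comp (by rw [hσx]; exact (hball hzb).2.1) hσ)
        (AnalyticAt.comp (by rw [hσx]; exact (hball hzb).2.2.1) hσ)
        (by simp [hσx, hzΦ])
        (by
          filter_upwards [hT] with τ hτ hτ0
          have h1 := hτ.1.continuousAt.tendsto.eventually ((hball hτ.2.2.2.2).2.2.2 hτ0)
          filter_upwards [h1, hτ.2.2.1] with τ' h1 h2 h3 h4
          have := h1 h3 h4
          rw [← h2, this, hτ.2.1])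
      obtain ⟨hτ1, hτ2, hτ3, hτ4, hτ5⟩ := hτ
      refine ⟨σ τ, (hball hτ5).1, hτΦ, e, ℓ, ?_, ?_⟩
      · have hρt : Tendsto ρ (𝓝 (σ τ)) (𝓝 τ) := by
          have := ρ.continuous.tendsto (σ τ)
          rwa [hτ2] at this
        filter_upwards [hτ4, hρt.eventually hiso, isOpen_ball.mem_nhds hτ5] with x h1 h2 h3 h4 h5
        have hx := h1 (hmin' x h3 h4 u)
        have := h2 (by simp [hx, h4]) (by change ℓ (P (σ (ρ x))) = ℓ (P (σ τ)); rw [hx]; exact h5)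
        rw [← hx, this]
      · intro O' hO'
        refine mem_of_superset (him _ (hτ1.continuousAt.preimage_mem_nhds hO')) ?_
        rintro _ ⟨τ', ⟨h1, h2⟩, rfl⟩
        exact ⟨σ τ', ⟨h1, h2⟩, rfl⟩

lemma count {N k e : ℕ} {Φ : (Fin N → ℂ) → (Fin k → ℂ)} {Q : (Fin N → ℂ) → (Fin e → ℂ)}
    {z : Fin N → ℂ} (hΦ : AnalyticAt ℂ Φ z) (hQ : AnalyticAt ℂ Q z)
    (hiso : ∀ᶠ x in 𝓝 z, Φ x = Φ z → Q x = Q z → x = z) : N ≤ k + e := by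
  by_contra hlt
  push Not at hlt
  obtain ⟨d, rfl⟩ : ∃ d, N = k + e + (d + 1) := ⟨N - (k + e) - 1, by omega⟩
  have hfr : Module.finrank ℂ (((Fin k → ℂ) × (Fin e → ℂ)) × (Fin (d + 1) → ℂ)) =
      Module.finrank ℂ (Fin (k + e + (d + 1)) → ℂ) := by
    rw [Module.finrank_prod, Module.finrank_prod]; simp only [Module.finrank_fin_fun]
  let L : (((Fin k → ℂ) × (Fin e → ℂ)) × (Fin (d + 1) → ℂ)) ≃L[ℂ] (Fin (k + e + (d + 1)) → ℂ) :=
    ContinuousLinearEquiv.ofFinrankEq hfr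
  have hLa : AnalyticAt ℂ (fun x => L ((Φ x, Q x), 0)) z :=
    (L.toContinuousLinearMap.analyticAt _).comp
      (((hΦ.prod hQ).prod (analyticAt_const (v := (0 : Fin (d + 1) → ℂ)))))
  have h := omt (f := fun x => L ((Φ x, Q x), 0)) (a := z) (O := univ)
    hLa (by
      filter_upwards [hiso] with x h1 h2
      have := L.injective h2
      simp only [Prod.mk.injEq, and_true] at this
      exact h1 this.1 this.2) univ_mem
  let π : (Fin (k + e + (d + 1)) → ℂ) → (Fin (d + 1) → ℂ) := fun w => (L.symm w).2
  have hπ : IsOpenMap π := isOpenMap_snd.comp L.symm.toHomeomorph.isOpenMap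
  have h2 := hπ.image_mem_nhds h
  have h3 : π '' ((fun x => L ((Φ x, Q x), 0)) '' univ) ⊆ {0} := by
    rintro _ ⟨_, ⟨x, -, rfl⟩, rfl⟩
    simp [π]
  have h4 : π (L ((Φ z, Q z), 0)) = 0 := by simp [π]
  rw [h4] at h2
  have h5 : ({0} : Set (Fin (d + 1) → ℂ)) ∈ 𝓝 0 := mem_of_superset h2 h3
  have h6 : ∀ᶠ w in 𝓝[≠] (0 : Fin (d + 1) → ℂ), False := by
    filter_upwards [mem_nhdsWithin_of_mem_nhds h5, self_mem_nhdsWithin] with w hw hw'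
    exact hw' hw
  exact h6.exists.elim fun _ h => h

lemma finite_iso {X : Type*} [TopologicalSpace X] [T1Space X] {T : Set X} (hT : T.Finite) (x : X) :
    ∀ᶠ z in 𝓝 x, z ∈ T → z = x := by
  have hcl := (hT.subset (sdiff_subset (t := {x}))).isClosed
  have : ∀ᶠ z in 𝓝 x, z ∉ T \ {x} := hcl.isOpen_compl.mem_nhds (by simp)
  filter_upwards [this] with z hz h
  by_contra h'
  exact hz ⟨h, h'⟩

lemma lower {n : ℕ} {F : (Fin n → ℂ) → (Fin (n + 1) → ℂ)} {W : Set (Fin n → ℂ)} (hW : IsOpen W)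
    (hF : ∀ w ∈ W, AnalyticAt ℂ F w) (hfin : ∀ y, {w ∈ W | F w = y}.Finite)
    {a b : Fin n → ℂ} (ha : a ∈ W) (hb : b ∈ W) (hab : a ≠ b) (h : F a = F b)
    {O : Set (Fin (n + 1) → ℂ)} (hO : O ∈ 𝓝 (F a)) :
    2 * ((n - 1 : ℕ) : ℝ≥0∞) ≤
      dimH (O ∩ {y | ∃ a ∈ W, ∃ b ∈ W, a ≠ b ∧ F a = y ∧ F b = y}) := by
  let L : (Fin (n + n) → ℂ) ≃L[ℂ] (Fin n → ℂ) × (Fin n → ℂ) :=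
    ContinuousLinearEquiv.ofFinrankEq (by simp)
  let p1 : (Fin (n + n) → ℂ) →L[ℂ] (Fin n → ℂ) := (ContinuousLinearMap.fst ℂ _ _).comp
    (L : (Fin (n + n) → ℂ) →L[ℂ] (Fin n → ℂ) × (Fin n → ℂ))
  let p2 : (Fin (n + n) → ℂ) →L[ℂ] (Fin n → ℂ) := (ContinuousLinearMap.snd ℂ _ _).comp
    (L : (Fin (n + n) → ℂ) →L[ℂ] (Fin n → ℂ) × (Fin n → ℂ))
  have hinj : ∀ x z, p1 x = p1 z → p2 x = p2 z → x = z := fun x z h1 h2 =>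
    L.injective (Prod.ext h1 h2)
  set z0 := L.symm (a, b) with hz0
  have hp1 : p1 z0 = a := by simp [p1, hz0]
  have hp2 : p2 z0 = b := by simp [p2, hz0]
  set G : Set (Fin (n + n) → ℂ) := {z | p1 z ∈ W ∧ p2 z ∈ W ∧ p1 z ≠ p2 z} with hG
  have hGo : IsOpen G := (hW.preimage p1.continuous).inter
    ((hW.preimage p2.continuous).inter (isOpen_ne_fun p1.continuous p2.continuous))
  have hz0G : z0 ∈ G := by simp only [hG, mem_ofPred_eq, hp1, hp2]; exact ⟨ha, hb, hab⟩
  let P : (Fin (n + n) → ℂ) → (Fin (n + 1) → ℂ) := fun z => F (p1 z)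
  let Φ : (Fin (n + n) → ℂ) → (Fin (n + 1) → ℂ) := fun z => F (p1 z) - F (p2 z)
  have hPa : ∀ z ∈ G, AnalyticAt ℂ P z := fun z hz => (hF _ hz.1).comp (p1.analyticAt z)
  have hΦa : ∀ z ∈ G, AnalyticAt ℂ Φ z := fun z hz =>
    (hPa z hz).sub ((hF _ hz.2.1).comp (p2.analyticAt z))
  have hPO : P ⁻¹' O ∈ 𝓝 z0 := (hPa z0 hz0G).continuousAt.preimage_mem_nhds (by
    simp only [P, hp1]; exact hO)
  obtain ⟨O1, hO1, hO1o, hz0O⟩ := _root_.mem_nhds_iff.1 (inter_mem hPO (hGo.mem_nhds hz0G))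
  obtain ⟨z, hz, hzΦ, e, ℓ, hiso, him⟩ := smooth_lemma (n + 1) (n + 1) (n + n) Φ P z0 O1
    (hO1o.mem_nhds hz0O) (hΦa z0 hz0G) (hPa z0 hz0G) (by simp [Φ, hp1, hp2, h]) (by
      filter_upwards [hGo.mem_nhds hz0G] with x hx hx0
      have hT : {z | (p1 z ∈ W ∧ F (p1 z) = P x) ∧ (p2 z ∈ W ∧ F (p2 z) = P x)}.Finite := by
        refine (((hfin (P x)).prod (hfin (P x))).preimage (f := L) L.injective.injOn).subset ?_
        intro z hz
        exact ⟨hz.1, hz.2⟩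
      filter_upwards [finite_iso hT x, hGo.mem_nhds hx] with z h1 h2 h3 h4
      refine h1 ⟨⟨h2.1, h4⟩, h2.2.1, ?_⟩
      rw [← h4]
      exact (sub_eq_zero.1 h3).symm)
  have hzG := (hO1 hz).2
  have hc : n + n ≤ (n + 1) + e := count (Q := fun x => ℓ (P x)) (hΦa z hzG)
    ((ℓ.analyticAt _).comp (hPa z hzG)) (by rw [hzΦ]; exact hiso)
  have hd := Real.dimH_of_mem_nhds (him O1 (hO1o.mem_nhds hz))
  rw [finrank_real] at hd
  calc 2 * ((n - 1 : ℕ) : ℝ≥0∞) = ((2 * (n - 1) : ℕ) : ℝ≥0∞) := by push_cast; rfl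
    _ ≤ ((2 * e : ℕ) : ℝ≥0∞) := by
      rw [Nat.cast_le]; omega
    _ = _ := hd.symm
    _ ≤ dimH (ℓ '' (O ∩ {y | ∃ a ∈ W, ∃ b ∈ W, a ≠ b ∧ F a = y ∧ F b = y})) := by
      apply dimH_mono
      rintro _ ⟨x, ⟨hx, hx0⟩, rfl⟩
      have hxG := (hO1 hx).2
      exact ⟨P x, ⟨(hO1 hx).1, p1 x, hxG.1, p2 x, hxG.2.1, hxG.2.2, rfl,
        (sub_eq_zero.1 hx0).symm⟩, rfl⟩
    _ ≤ _ := ℓ.lipschitz.dimH_image_le _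

end
end DPD

namespace DPD
section
open Set Filter Topology Metric
open scoped ENNReal NNReal ContDiff

def Good {N : ℕ} (g : (Fin N → ℂ) → ℂ) (y : Fin N → ℂ) : Prop :=
  ∃ (φ : (Fin N → ℂ) → ℂ) (e : Fin N → ℂ), AnalyticAt ℂ φ y ∧ φ y = 0 ∧ fderiv ℂ φ y e ≠ 0 ∧
    ∀ᶠ x in 𝓝 y, (g x = 0 ↔ φ x = 0)

lemma good_open {N : ℕ} {g : (Fin N → ℂ) → ℂ} {y : Fin N → ℂ} (h : Good g y) :
    ∀ᶠ x in 𝓝 y, g x = 0 → Good g x := by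
  obtain ⟨φ, e, h1, h2, h3, h4⟩ := h
  have hc : ContinuousAt (dd e φ 1) y := (dd_analyticAt h1 1).continuousAt
  filter_upwards [h1.eventually_analyticAt, h4, h4.eventually_nhds, hc.eventually_ne h3]
    with x a1 a2 a3 a4 h0
  exact ⟨φ, e, a1, a2.1 h0, a4, a3⟩

lemma taylor_sep {N : ℕ} {g : (Fin N → ℂ) → ℂ} {y e : Fin N → ℂ} (hg : AnalyticAt ℂ g y) {k : ℕ}
    (hk : dd e g k y ≠ 0) :
    ∃ R > (0 : ℝ), ∀ᶠ p in 𝓝 y, ∀ t ∈ ball (0 : ℂ) R, (∀ j < k, dd e g j p = 0) →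
      g (p + t • e) = 0 → t ^ k = 0 := by
  set c := dd e g k y with hc
  set ε : ℝ := ‖c‖ / (2 * k.factorial) with hε
  have hf : (0 : ℝ) < k.factorial := by exact_mod_cast k.factorial_pos
  have hcp : 0 < ‖c‖ := norm_pos_iff.2 hk
  have hεp : 0 < ε := by positivity
  have hcont : ContinuousAt (dd e g k) y := (dd_analyticAt hg k).continuousAt
  have hev : ∀ᶠ x in 𝓝 y, AnalyticAt ℂ g x ∧ ‖dd e g k x - c‖ < ε := by
    filter_upwards [hg.eventually_analyticAt, hcont.eventually (ball_mem_nhds c hεp)] with x h1 h2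
    exact ⟨h1, by simpa [dist_eq_norm] using h2⟩
  have hT : Tendsto (fun q : (Fin N → ℂ) × ℂ => q.1 + q.2 • e) (𝓝 y ×ˢ 𝓝 0) (𝓝 y) := by
    have : Continuous (fun q : (Fin N → ℂ) × ℂ => q.1 + q.2 • e) := by fun_prop
    have := this.tendsto (y, 0)
    simpa [nhds_prod_eq] using this
  obtain ⟨A, hA, B, hB, hAB⟩ := mem_prod_iff.1 (hT hev)
  obtain ⟨R, hR, hRB⟩ := Metric.mem_nhds_iff.1 hB
  refine ⟨R, hR, ?_⟩
  filter_upwards [hA] with p hp t ht h0 hgt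
  have hmem : ∀ s ∈ ball (0 : ℂ) R, AnalyticAt ℂ g (p + s • e) ∧ ‖dd e g k (p + s • e) - c‖ < ε :=
    fun s hs => hAB (⟨hp, hRB hs⟩ : (p, s) ∈ A ×ˢ B)
  have := taylor_est k (fun j s => dd e g j (p + s • e)) c ε R
    (fun j _ s hs => dd_line (hmem s hs).1 j) (fun j hj => by simpa using h0 j hj)
    (fun s hs => (hmem s hs).2.le) t ht
  have h1 : dd e g 0 (p + t • e) = 0 := hgt
  simp only [h1, zero_sub, norm_neg, norm_div, norm_mul, norm_pow, Complex.norm_natCast] at this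
  have h2 : ‖t‖ ^ k = 0 := by
    by_contra hne
    have hp : 0 < ‖t‖ ^ k := lt_of_le_of_ne (by positivity) (Ne.symm hne)
    have h3 : ‖c‖ * ‖t‖ ^ k / k.factorial = 2 * (ε * ‖t‖ ^ k) := by
      rw [hε]; field_simp
    rw [h3] at this
    have : 0 < ε * ‖t‖ ^ k := by positivity
    linarith
  rw [← norm_pow] at h2
  exact norm_eq_zero.1 h2

lemma bad_dim {N : ℕ} {g : (Fin (N + 2) → ℂ) → ℂ} {U : Set (Fin (N + 2) → ℂ)}
    (hg : ∀ y ∈ U, AnalyticAt ℂ g y) (hne : ∀ y ∈ U, ¬ ∀ᶠ z in 𝓝 y, g z = 0) :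
    dimH {y ∈ U | g y = 0 ∧ ¬ Good g y} ≤ 2 * (N : ℝ≥0∞) := by
  let d : ℕ → (Fin (N + 2) → ℂ) := TopologicalSpace.denseSeq _
  let S : ℕ × ℕ → Set (Fin (N + 2) → ℂ) :=
    fun m => {x ∈ {y ∈ U | g y = 0 ∧ ¬ Good g y} |
      (∀ j ≤ m.2, dd (d m.1) g j x = 0) ∧ dd (d m.1) g (m.2 + 1) x ≠ 0}
  have hsub : {y ∈ U | g y = 0 ∧ ¬ Good g y} ⊆ ⋃ m, S m := by
    intro x hx
    obtain ⟨e, ⟨m, rfl⟩, hk⟩ := exists_dir (hg x hx.1) (hne x hx.1)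
      (TopologicalSpace.denseRange_denseSeq (Fin (N + 2) → ℂ))
    obtain ⟨k, h1, h2⟩ := exists_order hx.2.1 hk
    exact mem_iUnion.2 ⟨(m, k), hx, h1, h2⟩
  refine (dimH_mono hsub).trans ?_
  rw [dimH_iUnion]
  refine iSup_le fun m => dimH_le_of_local ?_
  obtain ⟨m, k⟩ := m
  rintro y ⟨⟨hyU, hy0, hyB⟩, h1, h2⟩
  simp only at h1 h2
  set e := d m with he
  have hga := hg y hyU
  obtain ⟨ρ, σ, hker, hσ, hσy, hM, hN⟩ := chart (dd_analyticAt hga k) (h1 k le_rfl) h2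
  have hσt : Tendsto σ (𝓝 (ρ y)) (𝓝 y) := by
    have := hσ.continuousAt.tendsto
    rwa [hσy] at this
  have hρt : Tendsto ρ (𝓝 y) (𝓝 (ρ y)) := ρ.continuous.tendsto y
  by_cases hA : ∀ j ≤ k, ∀ᶠ τ in 𝓝 (ρ y), dd e g j (σ τ) = 0
  · exfalso
    apply hyB
    refine ⟨dd e g k, e, dd_analyticAt hga k, h1 k le_rfl, h2, ?_⟩
    have hA' : ∀ᶠ τ in 𝓝 (ρ y), ∀ j < k + 1, dd e g j (σ τ) = 0 := by
      have := (Finset.eventually_all (Finset.range (k + 1))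
        (l := 𝓝 (ρ y)) (p := fun j τ => dd e g j (σ τ) = 0)).2
        (fun j hj => hA j (by simpa [Nat.lt_succ_iff] using hj))
      simpa using this
    obtain ⟨R, hR, hsep⟩ := taylor_sep hga h2
    have he0 : e ≠ 0 := by
      rintro h
      apply h2
      change fderiv ℂ (dd e g k) y e = 0
      rw [h]; simp
    have hsm : ∀ᶠ x in 𝓝 y, ‖x - σ (ρ x)‖ < R * ‖e‖ := by
      have ht : Tendsto (fun x => ‖x - σ (ρ x)‖) (𝓝 y) (𝓝 ‖y - y‖) :=
        (tendsto_id.sub (hσt.comp hρt)).norm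
      simp only [sub_self, norm_zero] at ht
      exact ht.eventually (gt_mem_nhds (by have := norm_pos_iff.2 he0; positivity))
    filter_upwards [hN, hρt.eventually hA', hρt.eventually hM, hρt.eventually (hσt.eventually hsep),
      hsm] with x a1 a2 a3 a4 a5
    constructor
    · intro hx
      obtain ⟨t, ht⟩ := hker (x - σ (ρ x)) (by rw [map_sub, a3.2, sub_self])
      have hxt : σ (ρ x) + t • e = x := by rw [← ht]; simp
      have htR : t ∈ ball (0 : ℂ) R := by
        rw [ht, norm_smul] at a5
        rw [mem_ball_zero_iff]
        exact lt_of_mul_lt_mul_right a5 (norm_nonneg _)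
      have := a4 t htR a2 (by rw [hxt]; exact hx)
      have ht0 : t = 0 := by simpa using this
      rw [ht0, zero_smul, add_zero] at hxt
      rw [← hxt]
      exact a2 k (by omega)
    · intro hx
      have := a2 0 (by omega)
      rw [a1 hx] at this
      exact this
  · push Not at hA
    obtain ⟨j, hj, hjn⟩ := hA
    have hψ : AnalyticAt ℂ (fun τ => dd e g j (σ τ)) (ρ y) :=
      AnalyticAt.comp (by rw [hσy]; exact dd_analyticAt hga j) hσ
    obtain ⟨r, hr, hball⟩ := Metric.eventually_nhds_iff_ball.1
      (hσ.eventually_analyticAt.and hψ.eventually_analyticAt)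
    refine ⟨_, hN.and (hρt.eventually (ball_mem_nhds _ hr)), ?_⟩
    calc _ ≤ dimH (σ '' {τ ∈ ball (ρ y) r | dd e g j (σ τ) = 0}) := by
          apply dimH_mono
          rintro z ⟨hz, hz1, hz2⟩
          have hz3 := hz1 (hz.2.1 k le_rfl)
          refine ⟨ρ z, ⟨hz2, ?_⟩, hz3⟩
          rw [hz3]
          exact hz.2.1 j hj
      _ ≤ dimH {τ ∈ ball (ρ y) r | dd e g j (σ τ) = 0} :=
          dimH_image_le_of_analytic (fun x hx => (hball x hx.1).1)
      _ ≤ _ := by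
          refine dimH_zero (J := fun τ => dd e g j (σ τ)) (fun x hx => (hball x hx).2) ?_
          intro x hx hx0
          apply hjn
          have := AnalyticOnNhd.eqOn_zero_of_preconnected_of_eventuallyEq_zero
            (f := fun τ => dd e g j (σ τ)) (U := ball (ρ y) r)
            (fun x hx => (hball x hx).2) (convex_ball _ _).isPreconnected hx hx0
          filter_upwards [ball_mem_nhds (ρ y) hr] with τ hτ using not_not.2 (this hτ)

lemma double_bad {n : ℕ} {F : (Fin n → ℂ) → (Fin (n + 1) → ℂ)} {W : Set (Fin n → ℂ)} (hW : IsOpen W)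
    (hF : ∀ w ∈ W, AnalyticAt ℂ F w) (hfin : ∀ y, {w ∈ W | F w = y}.Finite)
    (hgen : F '' W ⊆ closure {y | {w ∈ W | F w = y}.ncard = 1})
    {g : (Fin (n + 1) → ℂ) → ℂ} (hgF : ∀ w ∈ W, g (F w) = 0)
    {a b : Fin n → ℂ} (ha : a ∈ W) (hb : b ∈ W) (hab : a ≠ b) (h : F a = F b) :
    ¬ Good g (F a) := by
  rintro ⟨φ, e, h1, h2, h3, h4⟩
  obtain ⟨ρ, σ, -, hσ, hσy, hM, hN⟩ := chart h1 h2 h3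
  have hσg : ∀ᶠ x in 𝓝 (F a), g x = 0 → σ (ρ x) = x := by
    filter_upwards [h4, hN] with x a1 a2 a3 using a2 (a1.1 a3)
  have key : ∀ c ∈ W, F c = F a → ∀ C ∈ 𝓝 c,
      ∀ᶠ τ in 𝓝 (ρ (F a)), ∃ c' ∈ C, c' ∈ W ∧ F c' = σ τ := by
    intro c hc hca C hC
    have hcF : ∀ᶠ x in 𝓝 c, σ (ρ (F x)) = F x := by
      have : Tendsto F (𝓝 c) (𝓝 (F a)) := by
        rw [← hca]; exact (hF c hc).continuousAt
      filter_upwards [this.eventually hσg, hW.mem_nhds hc] with x b1 b2 using b1 (hgF x b2)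
    have := omt (f := fun x => ρ (F x)) (a := c)
      (O := C ∩ {x | σ (ρ (F x)) = F x} ∩ W) ((ρ.analyticAt _).comp (hF c hc)) (by
        filter_upwards [hcF, finite_iso (hfin (F a)) c, hW.mem_nhds hc] with x b1 b2 b3 b4
        refine b2 ⟨b3, ?_⟩
        rw [← b1, b4, hca, hσy]) (inter_mem (inter_mem hC hcF) (hW.mem_nhds hc))
    rw [hca] at this
    filter_upwards [this] with τ hτ
    obtain ⟨c', ⟨⟨d1, d2⟩, d3⟩, rfl⟩ := hτ
    exact ⟨c', d1, d3, d2.symm⟩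
  obtain ⟨A, B, hA, hB, haA, hbB, hdis⟩ := t2_separation hab
  have hρt : Tendsto ρ (𝓝 (F a)) (𝓝 (ρ (F a))) := ρ.continuous.tendsto _
  have hev := (hρt.eventually (key a ha rfl A (hA.mem_nhds haA))).and
    ((hρt.eventually (key b hb h.symm B (hB.mem_nhds hbB))).and hσg)
  obtain ⟨x, hx, hx1⟩ := (mem_closure_iff_frequently.1 (hgen ⟨a, ha, rfl⟩)).and_eventually hev |>.exists
  obtain ⟨⟨a', a1, a2, a3⟩, ⟨b', b1, b2, b3⟩, hxg⟩ := hx1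
  obtain ⟨w, hw⟩ := Set.ncard_eq_one.1 hx
  have hwm : w ∈ {w ∈ W | F w = x} := by rw [hw]; rfl
  have hxs : σ (ρ x) = x := hxg (by rw [← hwm.2]; exact hgF w hwm.1)
  have ha' : a' ∈ {w ∈ W | F w = x} := ⟨a2, a3.trans hxs⟩
  have hb' : b' ∈ {w ∈ W | F w = x} := ⟨b2, b3.trans hxs⟩
  rw [hw] at ha' hb'
  have : a' = b' := ha'.trans hb'.symm
  exact disjoint_left.1 hdis a1 (this ▸ b1)

end
end DPD


/-!
Setting of the paper: `𝒰` is an open neighbourhood of the origin `𝟎` in `ℂ^{n+1}`,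
`𝒲 ⊆ ℂⁿ` is open (a disjoint union of `r` connected open sets `𝒲₁,…,𝒲_r`),
`S = {p₁,…,p_r}` with `pᵢ ∈ 𝒲ᵢ`, and `F : (𝒲,S) → (𝒰,𝟎)` is a finite, generically
one-to-one complex analytic map with `F⁻¹(𝟎) = S`.  By the Finite Mapping Theorem the
image of `F` is an `n`-dimensional hypersurface `X = V(g)` in `𝒰`, and
`h : (X,𝟎) → (ℂ,0)` is a complex analytic function.

Cohomological and sheaf-theoretic invariants that are not expressible in current
Mathlib (reduced integral cohomology of Milnor fibres, Milnor monodromy, stalk and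
costalk cohomology of the intersection cohomology complex `I•_X = F_*ℤ•_𝒲[n]`, of the
multiple-point complex `N• = ker(ℤ•_X[n] → I•_X)`, stalks of vanishing cycles, and
Euler characteristics of the strata `X_k ∩ M_{h,𝟎}`) are recorded as abstract fields of
the structure `Setup`, with their intended meaning described in the docstrings.
We model `ℂⁿ` by `Fin n → ℂ`.
-/

open scoped Classical ENNReal
open CategoryTheory

noncomputable section

/-- The setting of the paper; see the module docstring.  Geometric data is concrete,
while cohomological invariants are abstract fields whose intended meaning is given in
their docstrings. -/
structure Setup (n r : ℕ) : Type 1 where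
  /-- there is at least one point in `S = F⁻¹(𝟎)` -/
  hr : 0 < r
  /-- the open neighbourhood `𝒰` of the origin in `ℂ^{n+1}` -/
  U : Set (Fin (n+1) → ℂ)
  U_open : IsOpen U
  U_zero : 0 ∈ U
  /-- the open subset `𝒲 ⊆ ℂⁿ` (a disjoint union of `r` connected opens `𝒲ᵢ ∋ pᵢ`) -/
  W : Set (Fin n → ℂ)
  W_open : IsOpen W
  /-- the points `p₁,…,p_r` of `S = F⁻¹(𝟎)` -/
  p : Fin r → (Fin n → ℂ)
  p_mem : ∀ i, p i ∈ W
  p_inj : Function.Injective p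
  /-- the finite, generically one-to-one, complex analytic map `F : (𝒲,S) → (𝒰,𝟎)` -/
  F : (Fin n → ℂ) → (Fin (n+1) → ℂ)
  F_analytic : AnalyticOnNhd ℂ F W
  F_maps : Set.MapsTo F W U
  /-- `F` is a finite map: all fibres are finite -/
  F_finite : ∀ y, {w ∈ W | F w = y}.Finite
  /-- `F⁻¹(𝟎) = S = {p₁,…,p_r}` -/
  F_fiber_zero : {w ∈ W | F w = 0} = Set.range p
  /-- `F` is generically one-to-one: the points of the image having exactly one
  preimage are dense in the image -/
  F_gen_one_one : F '' W ⊆ closure {y | {w ∈ W | F w = y}.ncard = 1}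
  /-- a (reduced) defining function for the image hypersurface `X = V(g)` -/
  g : (Fin (n+1) → ℂ) → ℂ
  g_analytic : AnalyticOnNhd ℂ g U
  /-- the image of `F` is the hypersurface `X = V(g) ⊆ 𝒰` -/
  image_eq : F '' W = {y ∈ U | g y = 0}
  /-- the complex analytic function `h : (X,𝟎) → (ℂ,0)` (extended over `𝒰`) -/
  h : (Fin (n+1) → ℂ) → ℂ
  h_analytic : AnalyticOnNhd ℂ h U
  h_zero : h 0 = 0
  /-- `HM x k` is the reduced integral cohomology `H̃^k(M_{h,x}; ℤ)` of the Milnor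
  fibre of `h` at `x`, with the convention `H̃^{-1}(∅;ℤ) = ℤ` (and `H̃^k(∅;ℤ) = 0`
  otherwise). -/
  HM : (Fin (n+1) → ℂ) → ℤ → AddCommGrpCat.{0}
  /-- the Milnor monodromy automorphism of `H̃^k(M_{h,𝟎}; ℤ)` -/
  monHM : ∀ k, HM 0 k ≃+ HM 0 k
  /-- `HMF i k` is the reduced integral cohomology `H̃^k(M_{h∘F,pᵢ}; ℤ)` of the Milnor
  fibre of `h ∘ F` at `pᵢ` -/
  HMF : Fin r → ℤ → AddCommGrpCat.{0}
  /-- the Milnor monodromy automorphism of `H̃^k(M_{h∘F,pᵢ}; ℤ)` -/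
  monHMF : ∀ i k, HMF i k ≃+ HMF i k
  /-- `HI x k` is the stalk cohomology `H^k(I•_X)_x` of `I•_X := F_*ℤ•_𝒲[n]` -/
  HI : (Fin (n+1) → ℂ) → ℤ → AddCommGrpCat.{0}
  /-- `HIco x k` is the costalk cohomology `H^k(j_x^! I•_X)`, where `j_x : {x} ↪ X` -/
  HIco : (Fin (n+1) → ℂ) → ℤ → AddCommGrpCat.{0}
  /-- `HN x k` is the stalk cohomology `H^k(N•)_x` of the multiple-point complex
  `N• := ker(c : ℤ•_X[n] → I•_X)` -/
  HN : (Fin (n+1) → ℂ) → ℤ → AddCommGrpCat.{0}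
  /-- `HNco x k` is the costalk cohomology `H^k(j_x^! N•)` of the multiple-point
  complex -/
  HNco : (Fin (n+1) → ℂ) → ℤ → AddCommGrpCat.{0}
  /-- `HK x k` is the reduced integral cohomology `H̃^k(K_{X,x}; ℤ)` of the real link
  of `X` at `x` -/
  HK : (Fin (n+1) → ℂ) → ℤ → AddCommGrpCat.{0}
  /-- `HNphi k := H^k(φ_h N•[−n+1])_𝟎`, i.e. the `(r−1)`-reduced hypercohomology
  `H̃ℍ^k(D ∩ M_{h,𝟎}; N•[−n+1])` -/
  HNphi : ℤ → AddCommGrpCat.{0}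
  /-- the Milnor monodromy automorphism of `H̃ℍ^k(D ∩ M_{h,𝟎}; N•[−n+1])` -/
  monHNphi : ∀ k, HNphi k ≃+ HNphi k
  /-- `HND k := ℍ^k(D ∩ M_{h,𝟎}; N•[−n+1])`, the hypercohomology of the part of the
  Milnor fibre of `h` in `D` with coefficients in the shifted multiple-point complex -/
  HND : ℤ → AddCommGrpCat.{0}
  /-- `Hphi k := H^k(φ_h ℤ•_X)_𝟎`, the stalk cohomology at `𝟎` of the vanishing
  cycles of the constant sheaf `ℤ•_X` along `h` -/
  Hphi : ℤ → AddCommGrpCat.{0}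
  /-- `HphiF k := H^k(φ_h F_*ℤ•_𝒲)_𝟎` -/
  HphiF : ℤ → AddCommGrpCat.{0}
  /-- `chiXk k` is the Euler characteristic `χ(X_k ∩ M_{h,𝟎})` -/
  chiXk : ℕ → ℤ
  chiXk_fin : {k : ℕ | chiXk k ≠ 0}.Finite

namespace Setup

variable {n r : ℕ}

/-- the image hypersurface `X = F(𝒲) = V(g)` -/
def X (st : Setup n r) : Set (Fin (n+1) → ℂ) := st.F '' st.W

/-- `m x := |F⁻¹(x)|`, the number of points in the fibre of `F` over `x` (without
multiplicity) -/
def m (st : Setup n r) (y : Fin (n+1) → ℂ) : ℕ := {w ∈ st.W | st.F w = y}.ncard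

/-- the stratum `X_k := {x ∈ X | m(x) = k}` -/
def Xk (st : Setup n r) (k : ℕ) : Set (Fin (n+1) → ℂ) := {y ∈ st.X | st.m y = k}

/-- `D`, the closure of the image of the multiple-point set of `F`,
`D = closure (⋃_{k ≥ 2} X_k)` -/
def D (st : Setup n r) : Set (Fin (n+1) → ℂ) :=
  st.U ∩ closure (⋃ k, ⋃ (_ : 2 ≤ k), st.Xk k)

/-- the singular set `ΣX` of the (reduced) hypersurface `X = V(g)` -/
def SigmaX (st : Setup n r) : Set (Fin (n+1) → ℂ) :=
  {y ∈ st.X | fderiv ℂ st.g y = 0}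

/-- the topological/cohomological critical locus `Σ_top h` of `h`: the set of points
`x ∈ V(h)` such that the Milnor fibre `M_{h,x}` does not have the integral cohomology
of a point (i.e. has some non-zero reduced cohomology group) -/
def SigmaTop (st : Setup n r) : Set (Fin (n+1) → ℂ) :=
  {y ∈ st.X | st.h y = 0 ∧ ¬ ∀ k, Subsingleton (st.HM y k)}

/-- the critical locus `Σ(h∘F)` of `h ∘ F` on `𝒲` -/
def SigmaHF (st : Setup n r) : Set (Fin n → ℂ) :=
  {w ∈ st.W | fderiv ℂ (st.h ∘ st.F) w = 0}

/-- `𝟎` is an isolated point of `Σ_top h` -/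
def IsolatedCrit (st : Setup n r) : Prop :=
  0 ∈ st.SigmaTop ∧ ∃ ε > (0:ℝ), st.SigmaTop ∩ Metric.ball 0 ε ⊆ {0}

/-- the Milnor number `μ_𝟎(h)`: the rank of `H̃^{n-1}(M_{h,𝟎};ℤ)` -/
def mu0 (st : Setup n r) : ℕ := Module.finrank ℤ (st.HM 0 ((n : ℤ) - 1))

/-- the Milnor number `μ_{pᵢ}(h∘F)`: the rank of `H̃^{n-1}(M_{h∘F,pᵢ};ℤ)` -/
def muP (st : Setup n r) (i : Fin r) : ℕ := Module.finrank ℤ (st.HMF i ((n : ℤ) - 1))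

/-- the reduced Euler characteristic `χ̃(M_{h,𝟎})` of the Milnor fibre of `h` at `𝟎` -/
def chiM (st : Setup n r) : ℤ :=
  ∑ᶠ k : ℤ, (k.negOnePow : ℤ) * (Module.finrank ℤ (st.HM 0 k) : ℤ)

/-- the reduced Euler characteristic `χ̃(M_{h∘F,pᵢ})` -/
def chiMF (st : Setup n r) (i : Fin r) : ℤ :=
  ∑ᶠ k : ℤ, (k.negOnePow : ℤ) * (Module.finrank ℤ (st.HMF i k) : ℤ)

/-- the sum `∑_{k ≥ 2} (k−1)·χ(X_k ∩ M_{h,𝟎})` -/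
def chiMult (st : Setup n r) : ℤ :=
  ∑ᶠ (k : ℕ) (_ : 2 ≤ k), ((k : ℤ) - 1) * st.chiXk k

end Setup

/-- `dimAt A x d`: the (complex analytic) set `A` has complex dimension `d` at `x`,
expressed via Hausdorff dimension: all sufficiently small balls about `x` meet `A` in a
set of Hausdorff dimension `2d`.  (In particular `dimAt A x 0` holds when `x` is an
isolated point of `A` or `A` is locally empty at `x`, so "`dim_x A ≤ d`" can be
expressed as `∃ d' ≤ d, dimAt A x d'`.) -/
def dimAt {E : Type*} [EMetricSpace E] (A : Set E) (x : E) (d : ℕ) : Prop :=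
  ∃ ε₀ > (0 : ℝ≥0∞), ∀ ε, 0 < ε → ε ≤ ε₀ → dimH (A ∩ EMetric.ball x ε) = 2 * (d : ℝ≥0∞)

/-- The set `D`, the closure of the image of the multiple-point set
of `F`, is purely `(n−1)`-dimensional (this includes the possibility that `D` is
empty): every point of `D` has local dimension `n−1` in `D`. -/
theorem D_purely_dimensional {n r : ℕ} (st : Setup n r) :
    ∀ x ∈ st.D, dimAt st.D x (n - 1) := by
  intro x hx
  have hga : ∀ y ∈ st.U, AnalyticAt ℂ st.g y := fun y hy => st.g_analytic y hy
  have hFa : ∀ w ∈ st.W, AnalyticAt ℂ st.F w := fun w hw => st.F_analytic w hw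
  have hgF : ∀ w ∈ st.W, st.g (st.F w) = 0 := by
    intro w hw
    have : st.F w ∈ {y ∈ st.U | st.g y = 0} := by
      rw [← st.image_eq]; exact ⟨w, hw, rfl⟩
    exact this.2
  have hdbl : (⋃ k, ⋃ (_ : 2 ≤ k), st.Xk k) =
      {y | ∃ a ∈ st.W, ∃ b ∈ st.W, a ≠ b ∧ st.F a = y ∧ st.F b = y} := by
    ext y
    constructor
    · intro hy
      simp only [Set.mem_iUnion] at hy
      obtain ⟨k, hk, hy, hm⟩ := hy
      have h1 : 1 < {w ∈ st.W | st.F w = y}.ncard := by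
        change st.m y = k at hm
        rw [Setup.m] at hm
        omega
      obtain ⟨a, b, ha, hb, hab⟩ := (Set.one_lt_ncard_iff (st.F_finite y)).1 h1
      exact ⟨a, ha.1, b, hb.1, hab, ha.2, hb.2⟩
    · rintro ⟨a, ha, b, hb, hab, h1, h2⟩
      simp only [Set.mem_iUnion]
      refine ⟨st.m y, ?_, ⟨a, ha, h1⟩, rfl⟩
      exact (Set.one_lt_ncard_iff (st.F_finite y)).2 ⟨a, b, ⟨ha, h1⟩, ⟨hb, h2⟩, hab⟩
  have hDbad : st.D ⊆ {y ∈ st.U | st.g y = 0 ∧ ¬ DPD.Good st.g y} := by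
    rintro y ⟨hyU, hy⟩
    rw [hdbl, mem_closure_iff_frequently] at hy
    refine ⟨hyU, ?_, ?_⟩
    · by_contra h0
      obtain ⟨z, ⟨a, ha, b, hb, hab, h1, h2⟩, h3⟩ :=
        (hy.and_eventually ((hga y hyU).continuousAt.eventually_ne h0)).exists
      exact h3 (h1 ▸ hgF a ha)
    · intro hG
      obtain ⟨z, ⟨a, ha, b, hb, hab, h1, h2⟩, h3⟩ :=
        (hy.and_eventually (DPD.good_open hG)).exists
      subst h1
      exact DPD.double_bad st.W_open hFa st.F_finite st.F_gen_one_one hgF ha hb hab h2.symm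
        (h3 (hgF a ha))
  have hne : ∀ y ∈ st.U, ¬ ∀ᶠ z in nhds y, st.g z = 0 := by
    intro y hy h0
    have h1 : st.F '' st.W ∈ nhds y := by
      rw [st.image_eq]
      filter_upwards [h0, st.U_open.mem_nhds hy] with z a1 a2 using ⟨a2, a1⟩
    have h2 := Real.dimH_of_mem_nhds h1
    rw [DPD.finrank_real] at h2
    have h3 := (DPD.dimH_image_le_of_analytic hFa).trans (DPD.dimH_le_two_mul _)
    rw [h2] at h3
    have h4 : ((2 * (n + 1) : ℕ) : ℝ≥0∞) ≤ ((2 * n : ℕ) : ℝ≥0∞) := by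
      refine h3.trans (le_of_eq ?_)
      push_cast; rfl
    rw [Nat.cast_le] at h4
    omega
  refine ⟨1, one_pos, fun ε hε _ => le_antisymm ?_ ?_⟩
  · refine (dimH_mono (Set.inter_subset_left.trans hDbad)).trans ?_
    rcases n with _ | N
    · have : st.D = ∅ := by
        rw [Setup.D, hdbl]
        have : {y | ∃ a ∈ st.W, ∃ b ∈ st.W, a ≠ b ∧ st.F a = y ∧ st.F b = y} = ∅ := by
          ext y
          simp only [Set.mem_empty_iff_false, iff_false]
          rintro ⟨a, -, b, -, hab, -⟩
          exact hab (Subsingleton.elim _ _)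
        rw [this]; simp
      rw [this] at hx
      exact absurd hx (Set.notMem_empty x)
    · exact DPD.bad_dim hga hne
  · have hb : EMetric.ball x ε ∈ nhds x := EMetric.ball_mem_nhds x hε
    have hx2 := hx.2
    rw [hdbl, mem_closure_iff_frequently] at hx2
    have hO : st.U ∩ EMetric.ball x ε ∈ nhds x := Filter.inter_mem (st.U_open.mem_nhds hx.1) hb
    obtain ⟨y, ⟨a, ha, b, hb, hab, h1, h2⟩, h3⟩ :=
      (hx2.and_eventually (eventually_mem_nhds_iff.2 hO)).exists
    subst h1
    refine (DPD.lower st.W_open hFa st.F_finite ha hb hab h2.symm h3).trans (dimH_mono ?_)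
    rintro z ⟨⟨hzU, hzb⟩, hz⟩
    refine ⟨⟨hzU, subset_closure ?_⟩, hzb⟩
    rw [hdbl]; exact hz
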